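/- Let X_1,…,X_{K+1} be mutually independent finitely-valued random variables and let (X_1,…,X_{K+1},Y) be jointly distributed, with 𝒦 = {1,…,K}. Let S, S₁ ⊆ 𝒦 and Δ = S∖S₁. Then I(X_{S₁∪Δ∪{K+1}};Y|X_{𝒦∖(S₁∪Δ)}) ≤ I(X_Δ;Y|X_{(𝒦∖S)∪{K+1}}) + I(X_{S₁∪{K+1}};Y|X_{𝒦∖S₁}). -/

import Mathlib

open scoped Classical

noncomputable section

/-- Probability that random variable `X` takes value `x`, under pmf `p` on a finite sample space. -/
def probOf {Ω α : Type} [Fintype Ω] (p : Ω → ℝ) (X : Ω → α) (x : α) : ℝ :=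
  ∑ ω, if X ω = x then p ω else 0

/-- Shannon entropy of a finitely-valued random variable. -/
def Hent {Ω α : Type} [Fintype Ω] [Fintype α] (p : Ω → ℝ) (X : Ω → α) : ℝ :=
  -∑ x, probOf p X x * Real.log (probOf p X x)

/-- Conditional entropy `H(X | C)`. -/
def condHent {Ω α γ : Type} [Fintype Ω] [Fintype α] [Fintype γ]
    (p : Ω → ℝ) (X : Ω → α) (C : Ω → γ) : ℝ :=
  Hent p (fun ω => (X ω, C ω)) - Hent p C

/-- Conditional mutual information `I(A;B | C)`. -/
def IcondMut {Ω α β γ : Type} [Fintype Ω] [Fintype α] [Fintype β] [Fintype γ]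
    (p : Ω → ℝ) (A : Ω → α) (B : Ω → β) (C : Ω → γ) : ℝ :=
  condHent p A C + condHent p B C - condHent p (fun ω => (A ω, B ω)) C

/-- Mutual information `I(A;B)`. -/
def Imut {Ω α β : Type} [Fintype Ω] [Fintype α] [Fintype β]
    (p : Ω → ℝ) (A : Ω → α) (B : Ω → β) : ℝ :=
  Hent p A + Hent p B - Hent p (fun ω => (A ω, B ω))

/-- `p` is a probability mass function. -/
def IsPMF {Ω : Type} [Fintype Ω] (p : Ω → ℝ) : Prop :=
  (∀ ω, 0 ≤ p ω) ∧ ∑ ω, p ω = 1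

/-- The tuple `X_S = (X_k)_{k ∈ S}` as a random variable. -/
def tup {Ω ι : Type} {𝒳 : ι → Type} (X : ∀ k, Ω → 𝒳 k) (S : Finset ι) :
    Ω → ∀ k : S, 𝒳 k.1 :=
  fun ω k => X k.1 ω

/-- The random variables `X_1, …, X_K` are mutually independent. -/
def MutIndep {Ω ι : Type} [Fintype Ω] [Fintype ι] {𝒳 : ι → Type} [∀ k, Fintype (𝒳 k)]
    (p : Ω → ℝ) (X : ∀ k, Ω → 𝒳 k) : Prop :=
  ∀ x : ∀ k, 𝒳 k, probOf p (fun ω k => X k ω) x = ∏ k, probOf p (X k) (x k)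

section EntropyLemmas

variable {Ω α β γ : Type} [Fintype Ω] [Fintype α] [Fintype β] [Fintype γ] {p : Ω → ℝ}

theorem probOf_nonneg {α : Type} (hp : ∀ ω, 0 ≤ p ω) (X : Ω → α) (x : α) :
    0 ≤ probOf p X x :=
  Finset.sum_nonneg fun ω _ => by split_ifs <;> simp [hp]

theorem probOf_apply_pos {α : Type} (hp : ∀ ω, 0 ≤ p ω) (X : Ω → α) {ω : Ω} (hω : 0 < p ω) :
    0 < probOf p X (X ω) := by
  refine Finset.sum_pos' (fun ω _ => by split_ifs <;> simp [hp]) ⟨ω, Finset.mem_univ _, ?_⟩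
  simpa using hω

theorem sum_mul_comp_eq_sum_probOf (X : Ω → α) (f : α → ℝ) :
    ∑ ω, p ω * f (X ω) = ∑ x, probOf p X x * f x := by
  simp only [probOf, Finset.sum_mul, ite_mul, zero_mul]
  rw [Finset.sum_comm]
  simp

theorem Hent_eq_neg_sum (X : Ω → α) :
    Hent p X = -∑ ω, p ω * Real.log (probOf p X (X ω)) := by
  rw [Hent, sum_mul_comp_eq_sum_probOf X fun x => Real.log (probOf p X x)]

/-- Entropy depends only on the partition of the sample space induced by the variable. -/
theorem Hent_congr {X : Ω → α} {Z : Ω → β} (h : ∀ ω ω', X ω = X ω' ↔ Z ω = Z ω') :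
    Hent p X = Hent p Z := by
  simp only [Hent_eq_neg_sum, probOf, h]

theorem sum_probOf_pair_right {γ : Type} (A : Ω → α) (C : Ω → γ) (c : γ) :
    ∑ a, probOf p (fun ω => (A ω, C ω)) (a, c) = probOf p C c := by
  simp only [probOf, Prod.mk.injEq, ite_and]
  rw [Finset.sum_comm]
  simp

theorem sum_probOf (hp : IsPMF p) (X : Ω → α) : ∑ x, probOf p X x = 1 := by
  simpa [hp.2] using (sum_mul_comp_eq_sum_probOf (p := p) X fun _ => 1).symm

theorem Hent_submodular (hp : IsPMF p) (A : Ω → α) (B : Ω → β) (C : Ω → γ) :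
    Hent p (fun ω => (A ω, B ω, C ω)) + Hent p C ≤
      Hent p (fun ω => (A ω, C ω)) + Hent p (fun ω => (B ω, C ω)) := by
  set P := probOf p fun ω => (A ω, B ω, C ω) with hP
  set Q := probOf p fun ω => (A ω, C ω) with hQ
  set R := probOf p fun ω => (B ω, C ω) with hR
  set T := probOf p C with hT
  have hP0 : ∀ x, 0 ≤ P x := probOf_nonneg hp.1 _
  have hQ0 : ∀ x, 0 ≤ Q x := probOf_nonneg hp.1 _
  have hR0 : ∀ x, 0 ≤ R x := probOf_nonneg hp.1 _
  have hT0 : ∀ x, 0 ≤ T x := probOf_nonneg hp.1 _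
  let F : α × β × γ → ℝ := fun x => Q (x.1, x.2.2) * R x.2 / (P x * T x.2.2)
  have hF : ∑ ω, p ω * F (A ω, B ω, C ω) ≤ 1 := by
    rw [sum_mul_comp_eq_sum_probOf (fun ω => (A ω, B ω, C ω)) F, ← hP]
    calc ∑ x, P x * F x ≤ ∑ x : α × β × γ, Q (x.1, x.2.2) * R x.2 / T x.2.2 := by
          refine Finset.sum_le_sum fun x _ => ?_
          rcases (hP0 x).eq_or_lt with h | h
          · rw [← h, zero_mul]
            exact div_nonneg (mul_nonneg (hQ0 _) (hR0 _)) (hT0 _)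
          · refine le_of_eq ?_
            rw [mul_div_assoc', mul_div_mul_left _ _ h.ne']
      _ = ∑ c, (∑ a, Q (a, c)) * (∑ b, R (b, c)) / T c := by
          simp only [Fintype.sum_prod_type]
          simp_rw [Finset.sum_comm (s := (Finset.univ : Finset β))]
          rw [Finset.sum_comm]
          simp only [Finset.sum_mul_sum, Finset.sum_div]
      _ = ∑ c, T c := by
          refine Finset.sum_congr rfl fun c _ => ?_
          rw [hQ, hR, sum_probOf_pair_right, sum_probOf_pair_right, ← hT, mul_self_div_self]
      _ = 1 := sum_probOf hp C
  have key : ∑ ω, p ω * (Real.log (Q (A ω, C ω)) + Real.log (R (B ω, C ω))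
      - Real.log (P (A ω, B ω, C ω)) - Real.log (T (C ω))) ≤
      ∑ ω, p ω * (F (A ω, B ω, C ω) - 1) := by
    refine Finset.sum_le_sum fun ω _ => ?_
    rcases (hp.1 ω).eq_or_lt with h | h
    · simp [← h]
    · have h1 : 0 < P (A ω, B ω, C ω) := probOf_apply_pos hp.1 (fun ω => (A ω, B ω, C ω)) h
      have h2 : 0 < Q (A ω, C ω) := probOf_apply_pos hp.1 (fun ω => (A ω, C ω)) h
      have h3 : 0 < R (B ω, C ω) := probOf_apply_pos hp.1 (fun ω => (B ω, C ω)) h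
      have h4 : 0 < T (C ω) := probOf_apply_pos hp.1 C h
      refine mul_le_mul_of_nonneg_left ?_ h.le
      have hlog := Real.log_le_sub_one_of_pos (div_pos (mul_pos h2 h3) (mul_pos h1 h4))
      rw [Real.log_div (mul_pos h2 h3).ne' (mul_pos h1 h4).ne', Real.log_mul h2.ne' h3.ne',
        Real.log_mul h1.ne' h4.ne'] at hlog
      simp only [F]
      linarith
  simp only [mul_sub, mul_add, Finset.sum_sub_distrib, Finset.sum_add_distrib, mul_one, hp.2]
    at key
  simp only [Hent_eq_neg_sum, ← hP, ← hQ, ← hR, ← hT]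
  linarith

theorem Hent_eq_zero_of_subsingleton [Subsingleton α] (hp : IsPMF p) (X : Ω → α) :
    Hent p X = 0 := by
  rw [Hent_congr (Z := fun _ => ()) fun ω ω' => iff_of_true (Subsingleton.elim _ _) rfl]
  simp [Hent_eq_neg_sum, probOf, hp.2]

theorem Hent_pair_le (hp : IsPMF p) (A : Ω → α) (B : Ω → β) :
    Hent p (fun ω => (A ω, B ω)) ≤ Hent p A + Hent p B := by
  have h := Hent_submodular hp A B fun _ => ()
  rw [Hent_eq_zero_of_subsingleton hp fun _ => ()] at h
  rw [Hent_congr (X := fun ω => (A ω, B ω)) (Z := fun ω => (A ω, B ω, ())) (by simp),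
    Hent_congr (X := A) (Z := fun ω => (A ω, ())) (by simp),
    Hent_congr (X := B) (Z := fun ω => (B ω, ())) (by simp)]
  linarith

end EntropyLemmas

theorem tup_eq_iff {Ω ι : Type} {𝒳 : ι → Type} {X : ∀ k, Ω → 𝒳 k} {S : Finset ι} {ω ω' : Ω} :
    tup X S ω = tup X S ω' ↔ ∀ k ∈ S, X k ω = X k ω' := by
  simp [tup, funext_iff]

section TupleLemmas

variable {Ω ι : Type} [Fintype Ω] {𝒳 : ι → Type} {p : Ω → ℝ} {X : ∀ k, Ω → 𝒳 k}

variable [DecidableEq ι] [∀ k, Fintype (𝒳 k)]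

theorem Hent_tup_union_le (hp : IsPMF p) (U V : Finset ι) :
    Hent p (tup X (U ∪ V)) ≤ Hent p (tup X U) + Hent p (tup X V) := by
  refine le_of_eq_of_le (Hent_congr fun ω ω' => ?_) (Hent_pair_le hp (tup X U) (tup X V))
  simp only [Prod.mk.injEq, tup_eq_iff, Finset.mem_union]
  grind

theorem Hent_tup_le_sum (hp : IsPMF p) (U : Finset ι) :
    Hent p (tup X U) ≤ ∑ k ∈ U, Hent p (X k) := by
  induction U using Finset.induction_on with
  | empty => rw [Finset.sum_empty, Hent_eq_zero_of_subsingleton hp]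
  | insert a U ha ih =>
    rw [Finset.sum_insert ha, Finset.insert_eq]
    refine (Hent_tup_union_le hp _ _).trans (add_le_add (le_of_eq ?_) ih)
    exact Hent_congr fun ω ω' => by simp [tup_eq_iff]

theorem Hent_tup_univ_of_mutIndep [Fintype ι] (hp : IsPMF p) (h : MutIndep p X) :
    Hent p (tup X Finset.univ) = ∑ k, Hent p (X k) := by
  rw [Hent_congr (Z := fun ω k => X k ω) fun ω ω' => by rw [tup_eq_iff, funext_iff]; simp]
  simp only [Hent_eq_neg_sum, Finset.sum_neg_distrib]
  rw [Finset.sum_comm]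
  refine congrArg _ (Finset.sum_congr rfl fun ω _ => ?_)
  rcases (hp.1 ω).eq_or_lt with h0 | h0
  · simp [← h0]
  · rw [h, Real.log_prod fun k _ => (probOf_apply_pos hp.1 (X k) h0).ne', Finset.mul_sum]

theorem Hent_tup_of_mutIndep [Fintype ι] (hp : IsPMF p) (h : MutIndep p X) (U : Finset ι) :
    Hent p (tup X U) = ∑ k ∈ U, Hent p (X k) := by
  refine le_antisymm (Hent_tup_le_sum hp U) ?_
  have h1 := Hent_tup_union_le (X := X) hp U Uᶜ
  have h2 := Hent_tup_le_sum (X := X) hp Uᶜ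
  rw [Finset.union_compl, Hent_tup_univ_of_mutIndep hp h, ← Finset.sum_add_sum_compl U] at h1
  linarith

theorem Hent_tup_pair_submodular {β : Type} [Fintype β] (hp : IsPMF p) (Y : Ω → β)
    (U V : Finset ι) :
    Hent p (fun ω => (tup X (U ∪ V) ω, Y ω)) + Hent p (fun ω => (tup X (U ∩ V) ω, Y ω)) ≤
      Hent p (fun ω => (tup X U ω, Y ω)) + Hent p (fun ω => (tup X V ω, Y ω)) := by
  have h := Hent_submodular hp (tup X U) (tup X V) fun ω => (tup X (U ∩ V) ω, Y ω)
  rw [Hent_congr (Z := fun ω => (tup X (U ∪ V) ω, Y ω)),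
    Hent_congr (X := fun ω => (tup X U ω, _)) (Z := fun ω => (tup X U ω, Y ω)),
    Hent_congr (X := fun ω => (tup X V ω, _)) (Z := fun ω => (tup X V ω, Y ω))] at h
  · exact h
  all_goals
    intro ω ω'
    simp only [Prod.mk.injEq, tup_eq_iff, Finset.mem_union, Finset.mem_inter]
    grind

theorem IcondMut_tup {β : Type} [Fintype β] (Y : Ω → β) (U V : Finset ι) :
    IcondMut p (tup X U) Y (tup X V) =
      Hent p (tup X (U ∪ V)) - Hent p (tup X V) + Hent p (fun ω => (tup X V ω, Y ω)) -
        Hent p (fun ω => (tup X (U ∪ V) ω, Y ω)) := by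
  rw [IcondMut, condHent, condHent, condHent,
    Hent_congr (X := fun ω => (tup X U ω, tup X V ω)) (Z := tup X (U ∪ V)),
    Hent_congr (X := fun ω => (Y ω, tup X V ω)) (Z := fun ω => (tup X V ω, Y ω)),
    Hent_congr (X := fun ω => ((tup X U ω, Y ω), tup X V ω))
      (Z := fun ω => (tup X (U ∪ V) ω, Y ω))]
  · ring
  all_goals
    intro ω ω'
    simp only [Prod.mk.injEq, tup_eq_iff, Finset.mem_union]
    grind

end TupleLemmas

theorem stmt14 {K : ℕ} (hK : 1 ≤ K) {Ω : Type} [Fintype Ω]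
    {𝒳 : Fin (K + 1) → Type} [∀ k, Fintype (𝒳 k)] {𝒴 : Type} [Fintype 𝒴]
    (p : Ω → ℝ) (hp : IsPMF p)
    (X : ∀ k, Ω → 𝒳 k) (Y : Ω → 𝒴) (hind : MutIndep p X)
    (S S₁ : Finset (Fin (K + 1)))
    (hS : S ⊆ Finset.univ.erase (Fin.last K))
    (hS₁ : S₁ ⊆ Finset.univ.erase (Fin.last K)) :
    IcondMut p (tup X (insert (Fin.last K) (S₁ ∪ (S \ S₁)))) Y
        (tup X (Finset.univ.erase (Fin.last K) \ (S₁ ∪ (S \ S₁)))) ≤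
      IcondMut p (tup X (S \ S₁)) Y
          (tup X (insert (Fin.last K) (Finset.univ.erase (Fin.last K) \ S))) +
        IcondMut p (tup X (insert (Fin.last K) S₁)) Y
          (tup X (Finset.univ.erase (Fin.last K) \ S₁)) := by
  set E := Finset.univ.erase (Fin.last K) with hE
  set Δ := S \ S₁ with hΔ
  set C := insert (Fin.last K) (E \ S) with hC
  have hL : Fin.last K ∉ S := fun h => by simpa [hE] using hS h
  have hall : ∀ T ⊆ E, insert (Fin.last K) T ∪ E \ T = Finset.univ := by
    intro T hT
    ext k
    have := @hT k
    simp only [hE, Finset.mem_union, Finset.mem_insert, Finset.mem_sdiff, Finset.mem_erase,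
      Finset.mem_univ, iff_true]
    tauto
  have hunion : C ∪ E \ S₁ = Δ ∪ C := by
    ext k
    have := @hS k
    simp only [hC, hΔ, Finset.mem_union, Finset.mem_insert, Finset.mem_sdiff]
    tauto
  have hinter : C ∩ (E \ S₁) = E \ (S₁ ∪ Δ) := by
    ext k
    simp only [hC, hΔ, hE, Finset.mem_union, Finset.mem_inter, Finset.mem_insert,
      Finset.mem_sdiff, Finset.mem_erase]
    tauto
  have hdisj : ∀ T ⊆ C, Disjoint Δ T := by
    intro T hT
    refine Finset.disjoint_left.2 fun k hk hkT => ?_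
    have hkS := (Finset.mem_sdiff.1 hk).1
    rcases Finset.mem_insert.1 (hT hkT) with rfl | h
    · exact hL hkS
    · exact (Finset.mem_sdiff.1 h).2 hkS
  have hsplit : E \ S₁ = Δ ∪ E \ (S₁ ∪ Δ) := by
    ext k
    have := @hS k
    simp only [hΔ, Finset.mem_union, Finset.mem_sdiff]
    tauto
  have h1 : Hent p (tup X (Δ ∪ C)) = ∑ k ∈ Δ, Hent p (X k) + Hent p (tup X C) := by
    rw [Hent_tup_of_mutIndep hp hind, Hent_tup_of_mutIndep hp hind,
      Finset.sum_union (hdisj C subset_rfl)]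
  have h2 : Hent p (tup X (E \ S₁)) =
      ∑ k ∈ Δ, Hent p (X k) + Hent p (tup X (E \ (S₁ ∪ Δ))) := by
    rw [Hent_tup_of_mutIndep hp hind, Hent_tup_of_mutIndep hp hind, hsplit,
      Finset.sum_union (hdisj _ (hinter ▸ Finset.inter_subset_left))]
  have hsub := Hent_tup_pair_submodular (X := X) hp Y C (E \ S₁)
  rw [hunion, hinter] at hsub
  rw [IcondMut_tup, IcondMut_tup, IcondMut_tup, hall _ hS₁,
    hall _ (Finset.union_subset hS₁ (Finset.sdiff_subset.trans hS))]
  linarith
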